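/- Let ρ be a symmetric probability measure on ℝ which is not the Dirac mass at 0 and such that there exists v₀ > 0 with ∫_ℝ exp(v₀ z²) dρ(z) < +∞. Denote by σ² the variance of ρ and by μ₄ its fourth moment. Then, under the measures μ̃_{n,ρ}, the random variable S_n/n^{3/4} converges in distribution, as n → ∞, to the probability distribution on ℝ with density s ↦ (4μ₄/(3σ⁸))^{1/4} · Γ(1/4)^{-1} · exp(−μ₄ s⁴/(12σ⁸)) with respect to Lebesgue measure. -/

import Mathlib

open MeasureTheory Filter Topology Real

/-- `Sₙ(x) = x₁ + ⋯ + xₙ`. -/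
noncomputable def S (n : ℕ) (x : Fin n → ℝ) : ℝ := ∑ i, x i

/-- `Tₙ(x) = x₁² + ⋯ + xₙ²`. -/
noncomputable def T (n : ℕ) (x : Fin n → ℝ) : ℝ := ∑ i, (x i) ^ 2

/-- The (unnormalized) density `exp((1/2) Sₙ²/Tₙ) 1{Tₙ > 0}` of the Curie-Weiss model
of SOC with respect to `ρ^⊗n`. -/
noncomputable def weight (n : ℕ) (x : Fin n → ℝ) : ℝ :=
  if 0 < T n x then Real.exp (S n x ^ 2 / (2 * T n x)) else 0

/-- The normalization constant `Zₙ`. -/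
noncomputable def Z (ρ : Measure ℝ) (n : ℕ) : ℝ :=
  ∫ x, weight n x ∂(Measure.pi fun _ : Fin n => ρ)

/-- The measure `μ̃_{n,ρ}` on `ℝⁿ` with density `(1/Zₙ) exp((1/2) Sₙ²/Tₙ) 1{Tₙ > 0}`
with respect to `ρ^⊗n`. -/
noncomputable def tildeMu (ρ : Measure ℝ) (n : ℕ) : Measure (Fin n → ℝ) :=
  (ENNReal.ofReal (Z ρ n))⁻¹ •
    (Measure.pi fun _ : Fin n => ρ).withDensity fun x => ENNReal.ofReal (weight n x)

section LogCosh

lemma nonneg_of_hasDerivAt_nonneg {f f' : ℝ → ℝ} (h0 : f 0 = 0)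
    (hf : ∀ x, HasDerivAt f (f' x) x) (hf' : ∀ x, 0 < x → 0 ≤ f' x) {x : ℝ} (hx : 0 ≤ x) :
    0 ≤ f x := by
  have hm : MonotoneOn f (Set.Ici 0) := by
    refine monotoneOn_of_deriv_nonneg (convex_Ici 0)
      (fun y _ => (hf y).continuousAt.continuousWithinAt)
      (fun y _ => (hf y).differentiableAt.differentiableWithinAt) ?_
    intro y hy
    rw [interior_Ici] at hy
    rw [(hf y).deriv]
    exact hf' y hy
  simpa [h0] using hm (Set.self_mem_Ici) hx hx

lemma hasDerivAt_tanh (x : ℝ) : HasDerivAt Real.tanh (1 - Real.tanh x ^ 2) x := by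
  have h := (Real.hasDerivAt_sinh x).div (Real.hasDerivAt_cosh x) (Real.cosh_pos x).ne'
  have he : Real.tanh = Real.sinh / Real.cosh := by
    ext y
    exact Real.tanh_eq_sinh_div_cosh y
  have hc := (Real.cosh_pos x).ne'
  rw [Real.tanh_eq_sinh_div_cosh x, he]
  refine h.congr_deriv ?_
  field_simp

lemma hasDerivAt_log_cosh (x : ℝ) :
    HasDerivAt (fun y => Real.log (Real.cosh y)) (Real.tanh x) x := by
  rw [Real.tanh_eq_sinh_div_cosh]
  exact (Real.hasDerivAt_cosh x).log (Real.cosh_pos x).ne'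

lemma tanh_nonneg_of_nonneg {x : ℝ} (hx : 0 ≤ x) : 0 ≤ Real.tanh x := by
  rw [Real.tanh_eq_sinh_div_cosh]
  exact div_nonneg (Real.sinh_nonneg_iff.2 hx) (Real.cosh_pos x).le

lemma tanh_le_self {x : ℝ} (hx : 0 ≤ x) : Real.tanh x ≤ x := by
  have := nonneg_of_hasDerivAt_nonneg (f := fun y => y - Real.tanh y)
    (f' := fun y => 1 - (1 - Real.tanh y ^ 2)) (by simp)
    (fun y => (hasDerivAt_id y).sub (hasDerivAt_tanh y))
    (fun y _ => by nlinarith [sq_nonneg (Real.tanh y)]) hx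
  linarith

lemma sub_cube_le_tanh {x : ℝ} (hx : 0 ≤ x) : x - x ^ 3 / 3 ≤ Real.tanh x := by
  have := nonneg_of_hasDerivAt_nonneg (f := fun y => Real.tanh y - (y - y ^ 3 / 3))
    (f' := fun y => (1 - Real.tanh y ^ 2) - (1 - (3 : ℕ) * y ^ (3 - 1) / 3)) (by simp)
    (fun y => (hasDerivAt_tanh y).sub ((hasDerivAt_id y).sub ((hasDerivAt_pow 3 y).div_const 3)))
    (fun y hy => by
      have h1 := tanh_le_self hy.le
      have h2 := tanh_nonneg_of_nonneg hy.le
      norm_num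
      nlinarith) hx
  linarith

lemma tanh_le_quintic {x : ℝ} (hx : 0 ≤ x) :
    Real.tanh x ≤ x - x ^ 3 / 3 + 2 / 15 * x ^ 5 := by
  have := nonneg_of_hasDerivAt_nonneg
    (f := fun y => (y - y ^ 3 / 3 + 2 / 15 * y ^ 5) - Real.tanh y)
    (f' := fun y => (1 - (3 : ℕ) * y ^ (3 - 1) / 3 + 2 / 15 * ((5 : ℕ) * y ^ (5 - 1)))
      - (1 - Real.tanh y ^ 2)) (by simp)
    (fun y => ((((hasDerivAt_id y).sub ((hasDerivAt_pow 3 y).div_const 3))).add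
      ((hasDerivAt_pow 5 y).const_mul (2 / 15))).sub (hasDerivAt_tanh y))
    (fun y hy => by
      have h1 := sub_cube_le_tanh hy.le
      have h2 := tanh_nonneg_of_nonneg hy.le
      norm_num
      rcases le_total 0 (y - y ^ 3 / 3) with h | h
      · nlinarith [mul_self_le_mul_self h h1, sq_nonneg (y ^ 3)]
      · nlinarith [mul_nonneg hy.le (sub_nonneg.2 h), sq_nonneg (Real.tanh y), sq_nonneg (y ^ 2)]) hx
  linarith

lemma le_log_cosh_aux {x : ℝ} (hx : 0 ≤ x) :
    x ^ 2 / 2 - x ^ 4 / 12 ≤ Real.log (Real.cosh x) := by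
  have := nonneg_of_hasDerivAt_nonneg
    (f := fun y => Real.log (Real.cosh y) - (y ^ 2 / 2 - y ^ 4 / 12))
    (f' := fun y => Real.tanh y - ((2 : ℕ) * y ^ (2 - 1) / 2 - (4 : ℕ) * y ^ (4 - 1) / 12))
    (by simp)
    (fun y => (hasDerivAt_log_cosh y).sub
      (((hasDerivAt_pow 2 y).div_const 2).sub ((hasDerivAt_pow 4 y).div_const 12)))
    (fun y hy => by
      have h1 := sub_cube_le_tanh hy.le
      norm_num
      linarith) hx
  linarith

lemma log_cosh_le_aux {x : ℝ} (hx : 0 ≤ x) :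
    Real.log (Real.cosh x) ≤ x ^ 2 / 2 - x ^ 4 / 12 + x ^ 6 / 45 := by
  have := nonneg_of_hasDerivAt_nonneg
    (f := fun y => (y ^ 2 / 2 - y ^ 4 / 12 + y ^ 6 / 45) - Real.log (Real.cosh y))
    (f' := fun y => ((2 : ℕ) * y ^ (2 - 1) / 2 - (4 : ℕ) * y ^ (4 - 1) / 12
      + (6 : ℕ) * y ^ (6 - 1) / 45) - Real.tanh y)
    (by simp)
    (fun y => ((((hasDerivAt_pow 2 y).div_const 2).sub ((hasDerivAt_pow 4 y).div_const 12)).add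
      ((hasDerivAt_pow 6 y).div_const 45)).sub (hasDerivAt_log_cosh y))
    (fun y hy => by
      have h1 := tanh_le_quintic hy.le
      norm_num
      linarith) hx
  linarith

lemma cosh_le_exp_sub_one_mul {x : ℝ} (hx : 1 ≤ x) :
    Real.cosh x ≤ Real.exp (x - 1) * Real.cosh 1 := by
  have h : Real.cosh x = Real.cosh (x - 1) * Real.cosh 1 + Real.sinh (x - 1) * Real.sinh 1 := by
    rw [← Real.cosh_add]
    simp
  have h1 : Real.sinh 1 ≤ Real.cosh 1 := (Real.sinh_lt_cosh 1).le
  have h2 : 0 ≤ Real.sinh (x - 1) := Real.sinh_nonneg_iff.2 (by linarith)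
  rw [h, ← Real.cosh_add_sinh]
  nlinarith

lemma log_cosh_le_sub_aux {x : ℝ} (hx : 0 ≤ x) :
    Real.log (Real.cosh x) ≤ x ^ 2 / 2 - 1 / 20 * (x ^ 4 / (1 + x ^ 2)) := by
  have hd : x ^ 4 / (1 + x ^ 2) ≤ x ^ 4 := div_le_self (by positivity) (by nlinarith)
  have hd' : x ^ 4 / (1 + x ^ 2) ≤ x ^ 2 := by
    rw [div_le_iff₀ (by positivity)]
    nlinarith [sq_nonneg x]
  rcases le_total x 1 with h | h
  · have h1 := log_cosh_le_aux hx
    have h2 : x ^ 6 ≤ x ^ 4 := pow_le_pow_of_le_one hx h (by norm_num)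
    have h3 : 0 ≤ x ^ 4 := by positivity
    linarith
  · have h1 := Real.log_le_log (Real.cosh_pos x) (cosh_le_exp_sub_one_mul h)
    rw [Real.log_mul (Real.exp_pos _).ne' (Real.cosh_pos 1).ne', Real.log_exp] at h1
    have h2 := log_cosh_le_aux zero_le_one
    nlinarith [sq_nonneg (x - 1 - 1 / 9)]

/-- The Gaussian-normalised hyperbolic cosine `cosh u * exp (-u² / 2)`. -/
noncomputable def gaussCosh (u : ℝ) : ℝ := Real.cosh u * Real.exp (-(u ^ 2 / 2))

lemma gaussCosh_eq (u : ℝ) :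
    gaussCosh u = Real.exp (Real.log (Real.cosh |u|) - |u| ^ 2 / 2) := by
  rw [gaussCosh, sub_eq_add_neg, Real.exp_add, Real.exp_log (Real.cosh_pos _), Real.cosh_abs,
    sq_abs]

lemma exp_neg_le_gaussCosh (u : ℝ) : Real.exp (-(u ^ 4 / 12)) ≤ gaussCosh u := by
  rw [gaussCosh_eq, Real.exp_le_exp]
  have := le_log_cosh_aux (abs_nonneg u)
  rw [← (show Even 4 by decide).pow_abs u]
  linarith

lemma gaussCosh_le_exp (u : ℝ) : gaussCosh u ≤ Real.exp (-(u ^ 4 / 12) + u ^ 6 / 45) := by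
  rw [gaussCosh_eq, Real.exp_le_exp]
  have := log_cosh_le_aux (abs_nonneg u)
  rw [← (show Even 4 by decide).pow_abs u, ← (show Even 6 by decide).pow_abs u]
  linarith

lemma gaussCosh_le_exp_div (u : ℝ) :
    gaussCosh u ≤ Real.exp (-(1 / 20 * ((u ^ 2) ^ 2 / (1 + u ^ 2)))) := by
  rw [gaussCosh_eq, Real.exp_le_exp]
  have := log_cosh_le_sub_aux (abs_nonneg u)
  have h4 : |u| ^ 4 = (u ^ 2) ^ 2 := by rw [(show Even 4 by decide).pow_abs u]; ring
  rw [h4, sq_abs] at this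
  rw [sq_abs]
  linarith

lemma gaussCosh_nonneg (u : ℝ) : 0 ≤ gaussCosh u :=
  mul_nonneg (Real.cosh_pos u).le (Real.exp_pos _).le

lemma continuous_gaussCosh : Continuous gaussCosh := by
  unfold gaussCosh
  fun_prop

end LogCosh

section Kernel

/-- The average over all sign changes of `x` of the Gaussian-linearised weight. -/
noncomputable def kern (n : ℕ) (r t : ℝ) (x : Fin n → ℝ) : ℝ :=
  ∏ i, gaussCosh (r * t * x i / √(T n x))

lemma kern_nonneg (n : ℕ) (r t : ℝ) (x : Fin n → ℝ) : 0 ≤ kern n r t x :=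
  Finset.prod_nonneg fun _ _ => gaussCosh_nonneg _

lemma T_nonneg (n : ℕ) (x : Fin n → ℝ) : 0 ≤ T n x :=
  Finset.sum_nonneg fun _ _ => sq_nonneg _

lemma ratio_sq {n : ℕ} (r t : ℝ) (x : Fin n → ℝ) (i : Fin n) :
    (r * t * x i / √(T n x)) ^ 2 = (r * t) ^ 2 * x i ^ 2 / T n x := by
  rw [div_pow, Real.sq_sqrt (T_nonneg n x), mul_pow]

lemma sum_ratio_sq {n : ℕ} (r t : ℝ) {x : Fin n → ℝ} (hT : 0 < T n x) :
    ∑ i, (r * t * x i / √(T n x)) ^ 2 = (r * t) ^ 2 := by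
  simp_rw [ratio_sq]
  rw [← Finset.sum_div, ← Finset.mul_sum, ← T, mul_div_assoc, div_self hT.ne', mul_one]

lemma ratio_pow_four {n : ℕ} (r t : ℝ) (x : Fin n → ℝ) (i : Fin n) :
    (r * t * x i / √(T n x)) ^ 4 = (r * t) ^ 4 / T n x ^ 2 * x i ^ 4 := by
  rw [show (4 : ℕ) = 2 * 2 by norm_num, pow_mul, ratio_sq]
  ring

lemma ratio_pow_six {n : ℕ} (r t : ℝ) (x : Fin n → ℝ) (i : Fin n) :
    (r * t * x i / √(T n x)) ^ 6 = (r * t) ^ 6 / T n x ^ 3 * x i ^ 6 := by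
  rw [show (6 : ℕ) = 2 * 3 by norm_num, pow_mul, ratio_sq]
  ring

lemma kern_le {n : ℕ} {r : ℝ} (hr : 1 ≤ r) (hn : r ^ 4 = n) (t : ℝ) {x : Fin n → ℝ}
    (hT : 0 < T n x) : kern n r t x ≤ Real.exp (-(1 / 20 * (t ^ 4 / (1 + t ^ 2)))) := by
  set u : Fin n → ℝ := fun i => r * t * x i / √(T n x) with hu
  have h1 : kern n r t x ≤ Real.exp (∑ i, -(1 / 20 * ((u i ^ 2) ^ 2 / (1 + u i ^ 2)))) := by
    rw [Real.exp_sum]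
    exact Finset.prod_le_prod (fun i _ => gaussCosh_nonneg _) fun i _ => gaussCosh_le_exp_div _
  refine h1.trans (Real.exp_le_exp.2 ?_)
  rw [Finset.sum_neg_distrib, ← Finset.mul_sum]
  have h2 := Finset.sq_sum_div_le_sum_sq_div Finset.univ (fun i => u i ^ 2)
    (g := fun i => 1 + u i ^ 2) (fun i _ => by positivity)
  rw [Finset.sum_add_distrib, sum_ratio_sq r t hT] at h2
  simp only [Finset.sum_const, Finset.card_univ, Fintype.card_fin, nsmul_eq_mul, mul_one,
    ← hn] at h2
  have h3 : t ^ 4 / (1 + t ^ 2) ≤ ((r * t) ^ 2) ^ 2 / (r ^ 4 + (r * t) ^ 2) := by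
    rw [div_le_div_iff₀ (by positivity) (by positivity)]
    have : r ^ 2 ≤ r ^ 4 := pow_le_pow_right₀ hr (by norm_num)
    have h5 : 0 ≤ t ^ 6 := by positivity
    nlinarith [mul_le_mul_of_nonneg_left this h5]
  linarith

lemma exp_le_kern {n : ℕ} (r t : ℝ) (x : Fin n → ℝ) :
    Real.exp (-((r * t) ^ 4 / T n x ^ 2 * (∑ i, x i ^ 4) / 12)) ≤ kern n r t x := by
  have : -((r * t) ^ 4 / T n x ^ 2 * (∑ i, x i ^ 4) / 12)
      = ∑ i, -((r * t * x i / √(T n x)) ^ 4 / 12) := by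
    simp_rw [ratio_pow_four, Finset.sum_neg_distrib, ← Finset.sum_div, ← Finset.mul_sum]
  rw [this, Real.exp_sum]
  exact Finset.prod_le_prod (fun i _ => (Real.exp_pos _).le) fun i _ => exp_neg_le_gaussCosh _

lemma kern_le_exp {n : ℕ} (r t : ℝ) (x : Fin n → ℝ) :
    kern n r t x ≤ Real.exp (-((r * t) ^ 4 / T n x ^ 2 * (∑ i, x i ^ 4) / 12)
      + (r * t) ^ 6 / T n x ^ 3 * (∑ i, x i ^ 6) / 45) := by
  have : -((r * t) ^ 4 / T n x ^ 2 * (∑ i, x i ^ 4) / 12)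
      + (r * t) ^ 6 / T n x ^ 3 * (∑ i, x i ^ 6) / 45
      = ∑ i, (-((r * t * x i / √(T n x)) ^ 4 / 12) + (r * t * x i / √(T n x)) ^ 6 / 45) := by
    simp_rw [ratio_pow_four, ratio_pow_six, Finset.sum_add_distrib, Finset.sum_neg_distrib,
      ← Finset.sum_div, ← Finset.mul_sum]
  rw [this, Real.exp_sum]
  exact Finset.prod_le_prod (fun i _ => gaussCosh_nonneg _) fun i _ => gaussCosh_le_exp _

/-- The scale `n^{1/4}`. -/
noncomputable def scale (n : ℕ) : ℝ := (n : ℝ) ^ (1 / 4 : ℝ)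

lemma scale_pow_four (n : ℕ) : scale n ^ 4 = n := by
  rw [scale, ← Real.rpow_natCast, ← Real.rpow_mul (Nat.cast_nonneg n)]
  norm_num

lemma scale_pow_three (n : ℕ) : scale n ^ 3 = (n : ℝ) ^ (3 / 4 : ℝ) := by
  rw [scale, ← Real.rpow_natCast, ← Real.rpow_mul (Nat.cast_nonneg n)]
  norm_num

lemma one_le_scale {n : ℕ} (hn : 1 ≤ n) : 1 ≤ scale n :=
  Real.one_le_rpow (by exact_mod_cast hn) (by norm_num)

lemma tendsto_scale : Tendsto scale atTop atTop :=
  (tendsto_rpow_atTop (by norm_num)).comp tendsto_natCast_atTop_atTop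

lemma tendsto_kern {w : ℕ → ℝ} {m2 m4 m6 : ℝ} (hm2 : 0 < m2)
    (h2 : Tendsto (fun n : ℕ => (∑ i ∈ Finset.range n, w i ^ 2) / n) atTop (𝓝 m2))
    (h4 : Tendsto (fun n : ℕ => (∑ i ∈ Finset.range n, w i ^ 4) / n) atTop (𝓝 m4))
    (h6 : Tendsto (fun n : ℕ => (∑ i ∈ Finset.range n, w i ^ 6) / n) atTop (𝓝 m6)) (t : ℝ) :
    Tendsto (fun n : ℕ => kern n (scale n) t (fun i => w i)) atTop
      (𝓝 (Real.exp (-(m4 / (12 * m2 ^ 2) * t ^ 4)))) := by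
  have hT : ∀ n : ℕ, T n (fun i => w i) = ∑ i ∈ Finset.range n, w i ^ 2 := fun n =>
    Fin.sum_univ_eq_sum_range (fun i => w i ^ 2) n
  have hA : Tendsto (fun n : ℕ => (scale n * t) ^ 4 / T n (fun i => w i) ^ 2
      * (∑ i : Fin n, w i ^ 4) / 12) atTop (𝓝 (m4 / (12 * m2 ^ 2) * t ^ 4)) := by
    have h := ((h4.div (h2.pow 2) (by positivity)).mul_const (t ^ 4)).div_const 12
    have he : m4 / m2 ^ 2 * t ^ 4 / 12 = m4 / (12 * m2 ^ 2) * t ^ 4 := by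
      field_simp
    rw [he] at h
    refine h.congr' ?_
    filter_upwards [eventually_gt_atTop 0] with n hn
    have hn' : (0 : ℝ) < n := by exact_mod_cast hn
    rw [hT, Fin.sum_univ_eq_sum_range (fun i => w i ^ 4) n, mul_pow, scale_pow_four]
    simp only [Pi.div_apply]
    field_simp
  have hB : Tendsto (fun n : ℕ => (scale n * t) ^ 6 / T n (fun i => w i) ^ 3
      * (∑ i : Fin n, w i ^ 6) / 45) atTop (𝓝 0) := by
    have hs : Tendsto (fun n : ℕ => (scale n ^ 2)⁻¹) atTop (𝓝 0) :=
      (tendsto_pow_atTop two_ne_zero |>.comp tendsto_scale).inv_tendsto_atTop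
    have h := (((h6.div (h2.pow 3) (by positivity)).mul_const (t ^ 6)).div_const 45).mul hs
    rw [mul_zero] at h
    refine h.congr' ?_
    filter_upwards [eventually_gt_atTop 0] with n hn
    have hn' : (0 : ℝ) < n := by exact_mod_cast hn
    have hs' : 0 < scale n := zero_lt_one.trans_le (one_le_scale hn)
    rw [hT, Fin.sum_univ_eq_sum_range (fun i => w i ^ 6) n]
    simp only [Pi.div_apply]
    rw [← scale_pow_four n]
    field_simp
  refine tendsto_of_tendsto_of_tendsto_of_le_of_le ?_ ?_
    (fun n => exp_le_kern (scale n) t fun i => w i) (fun n => kern_le_exp (scale n) t fun i => w i)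
  · exact (Real.continuous_exp.tendsto _).comp hA.neg
  · have := (Real.continuous_exp.tendsto _).comp (hA.neg.add hB)
    rwa [add_zero] at this

end Kernel

section Symmetrization

/-- The sign attached to a Boolean. -/
def boolSign (b : Bool) : ℝ := if b then 1 else -1

lemma boolSign_sq (b : Bool) : boolSign b ^ 2 = 1 := by
  cases b <;> simp [boolSign]

/-- Change the signs of the coordinates of `x` according to `e`. -/
def signFlip (n : ℕ) (e : Fin n → Bool) (x : Fin n → ℝ) : Fin n → ℝ :=
  fun i => boolSign (e i) * x i

lemma T_flip (n : ℕ) (e : Fin n → Bool) (x : Fin n → ℝ) : T n (signFlip n e x) = T n x := by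
  simp [T, signFlip, mul_pow, boolSign_sq]

lemma measurePreserving_flip {ρ : Measure ℝ} [IsProbabilityMeasure ρ]
    (hsymm : ρ.map (fun x => -x) = ρ) (n : ℕ) (e : Fin n → Bool) :
    MeasurePreserving (signFlip n e) (Measure.pi fun _ : Fin n => ρ) (Measure.pi fun _ => ρ) := by
  refine measurePreserving_pi (f := fun i y => boolSign (e i) * y) _ _ fun i => ?_
  cases h : e i
  · simp only [boolSign, Bool.false_eq_true, if_false, neg_one_mul]
    exact ⟨measurable_neg, hsymm⟩
  · simp only [boolSign, if_true, one_mul]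
    exact MeasurePreserving.id ρ

lemma integral_eq_integral_average_flip {ρ : Measure ℝ} [IsProbabilityMeasure ρ]
    (hsymm : ρ.map (fun x => -x) = ρ) {n : ℕ} {G : (Fin n → ℝ) → ℝ}
    (hG : Integrable G (Measure.pi fun _ : Fin n => ρ)) :
    ∫ x, G x ∂(Measure.pi fun _ : Fin n => ρ)
      = ∫ x, (2 ^ n)⁻¹ * ∑ e : Fin n → Bool, G (signFlip n e x) ∂(Measure.pi fun _ : Fin n => ρ) := by
  have hmp := fun e => measurePreserving_flip hsymm n e
  have hint : ∀ e, ∫ x, G (signFlip n e x) ∂(Measure.pi fun _ : Fin n => ρ)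
      = ∫ x, G x ∂(Measure.pi fun _ : Fin n => ρ) := fun e => by
    have h := integral_map (hmp e).measurable.aemeasurable (f := G)
      (by rw [(hmp e).map_eq]; exact hG.aestronglyMeasurable)
    rw [(hmp e).map_eq] at h
    exact h.symm
  have hcomp : ∀ e, Integrable (fun x => G (signFlip n e x)) (Measure.pi fun _ : Fin n => ρ) :=
    fun e => (hmp e).integrable_comp_of_integrable hG
  rw [integral_const_mul, integral_finsetSum _ fun e _ => hcomp e]
  simp [hint]

lemma average_exp_flip (n : ℕ) (b : ℝ) (x : Fin n → ℝ) :
    (2 ^ n)⁻¹ * ∑ e : Fin n → Bool, Real.exp (b * S n (signFlip n e x))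
      = ∏ i, Real.cosh (b * x i) := by
  have h1 : ∀ e : Fin n → Bool, Real.exp (b * S n (signFlip n e x))
      = ∏ i, Real.exp (b * (boolSign (e i) * x i)) := fun e => by
    rw [S, Finset.mul_sum, Real.exp_sum]
    rfl
  have h2 := Finset.prod_univ_sum (fun _ : Fin n => (Finset.univ : Finset Bool))
    (fun i c => Real.exp (b * (boolSign c * x i)))
  rw [Fintype.piFinset_univ] at h2
  simp_rw [h1]
  rw [← h2]
  have h3 : ((2 : ℝ) ^ n)⁻¹ = ∏ _i : Fin n, (2 : ℝ)⁻¹ := by simp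
  rw [h3, ← Finset.prod_mul_distrib]
  refine Finset.prod_congr rfl fun i _ => ?_
  rw [Fintype.sum_bool, Real.cosh_eq]
  simp only [boolSign, if_true, Bool.false_eq_true, if_false, one_mul, neg_mul, mul_neg]
  ring

/-- The Gaussian-linearised weight. -/
noncomputable def gaussWeight (n : ℕ) (r t : ℝ) (x : Fin n → ℝ) : ℝ :=
  Real.exp (r * t * (S n x / √(T n x)) - (r * t) ^ 2 / 2)

lemma average_gaussWeight_flip (n : ℕ) (r t : ℝ) {x : Fin n → ℝ} (hT : 0 < T n x) :
    (2 ^ n)⁻¹ * ∑ e : Fin n → Bool, gaussWeight n r t (signFlip n e x) = kern n r t x := by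
  have h1 : ∀ e : Fin n → Bool, gaussWeight n r t (signFlip n e x)
      = Real.exp (r * t / √(T n x) * S n (signFlip n e x)) * Real.exp (-((r * t) ^ 2 / 2)) :=
    fun e => by
      rw [gaussWeight, T_flip, ← Real.exp_add]
      congr 1
      ring
  simp_rw [h1]
  rw [← Finset.sum_mul, ← mul_assoc, average_exp_flip, ← sum_ratio_sq r t hT, Finset.sum_div,
    ← Finset.sum_neg_distrib, Real.exp_sum, ← Finset.prod_mul_distrib]
  refine Finset.prod_congr rfl fun i _ => ?_
  rw [gaussCosh, div_mul_eq_mul_div]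

lemma S_sq_le (n : ℕ) (x : Fin n → ℝ) : S n x ^ 2 ≤ n * T n x := by
  have := sq_sum_le_card_mul_sum_sq (s := Finset.univ) (f := x)
  simpa [S, T] using this

lemma weight_nonneg (n : ℕ) (x : Fin n → ℝ) : 0 ≤ weight n x := by
  unfold weight
  split_ifs <;> positivity

lemma weight_le (n : ℕ) (x : Fin n → ℝ) : weight n x ≤ Real.exp (n / 2) := by
  unfold weight
  split_ifs with h
  · rw [Real.exp_le_exp, div_le_div_iff₀ (by positivity) two_pos]
    nlinarith [S_sq_le n x]
  · positivity

lemma gaussWeight_eq (n : ℕ) (r t : ℝ) {x : Fin n → ℝ} (hT : 0 < T n x) :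
    gaussWeight n r t x
      = weight n x * Real.exp (-(1 / 2) * (r * t - S n x / √(T n x)) ^ 2) := by
  rw [gaussWeight, weight, if_pos hT, ← Real.exp_add]
  congr 1
  have : S n x ^ 2 / (2 * T n x) = (S n x / √(T n x)) ^ 2 / 2 := by
    rw [div_pow, Real.sq_sqrt hT.le]
    ring
  rw [this]
  ring

lemma integral_comp_mul_sub (g : ℝ → ℝ) {r : ℝ} (hr : 0 < r) (b : ℝ) :
    ∫ t, g (r * t - b) = r⁻¹ * ∫ t, g t := by
  rw [Measure.integral_comp_mul_left (fun t => g (t - b)) r,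
    integral_sub_right_eq_self g b, abs_of_pos (inv_pos.2 hr), smul_eq_mul]

lemma integrable_comp_mul_sub {g : ℝ → ℝ} (hg : Integrable g) {r : ℝ} (hr : 0 < r) (b : ℝ) :
    Integrable fun t => g (r * t - b) :=
  (hg.comp_sub_right b).comp_mul_left' hr.ne'

lemma integrable_gaussWeight (n : ℕ) {r : ℝ} (hr : 0 < r) {x : Fin n → ℝ} (hT : 0 < T n x) :
    Integrable fun t => gaussWeight n r t x := by
  simp_rw [gaussWeight_eq n r _ hT]
  exact (integrable_comp_mul_sub (integrable_exp_neg_mul_sq (b := 1 / 2) (by norm_num)) hr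
    _).const_mul _

lemma integral_gaussWeight (n : ℕ) {r : ℝ} (hr : 0 < r) {x : Fin n → ℝ} (hT : 0 < T n x) :
    ∫ t, gaussWeight n r t x = r⁻¹ * √(2 * π) * weight n x := by
  simp_rw [gaussWeight_eq n r _ hT]
  rw [integral_const_mul, integral_comp_mul_sub (fun t => Real.exp (-(1 / 2) * t ^ 2)) hr,
    integral_gaussian]
  rw [show π / (1 / 2) = 2 * π by ring]
  ring

/-- The integral in `t` of `k (T x) t` against a family `a t x` of weights,
restricted to `T x > 0`. -/
noncomputable def mix (n : ℕ) (k : ℝ → ℝ → ℝ) (a : ℝ → (Fin n → ℝ) → ℝ) (x : Fin n → ℝ) : ℝ :=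
  if 0 < T n x then ∫ t, k (T n x) t * a t x else 0

lemma measurable_S (n : ℕ) : Measurable (S n) := by
  unfold S
  fun_prop

lemma measurable_T (n : ℕ) : Measurable (T n) := by
  unfold T
  fun_prop

lemma measurable_weight (n : ℕ) : Measurable (weight n) := by
  unfold weight
  have := measurable_S n
  have := measurable_T n
  exact Measurable.ite (measurableSet_lt measurable_const (measurable_T n)) (by fun_prop)
    measurable_const

lemma measurable_mix (n : ℕ) {k : ℝ → ℝ → ℝ} {a : ℝ → (Fin n → ℝ) → ℝ}
    (hk : Measurable (Function.uncurry k)) (ha : Measurable (Function.uncurry a)) :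
    Measurable (mix n k a) := by
  refine Measurable.ite (measurableSet_lt measurable_const (measurable_T n)) ?_ measurable_const
  have h : Measurable fun p : (Fin n → ℝ) × ℝ => k (T n p.1) p.2 * a p.2 p.1 :=
    (hk.comp (((measurable_T n).comp measurable_fst).prodMk measurable_snd)).mul
      (ha.comp (measurable_snd.prodMk measurable_fst))
  exact (h.stronglyMeasurable.integral_prod_right' (ν := volume)).measurable

lemma measurable_gaussWeight (n : ℕ) (r : ℝ) :
    Measurable (Function.uncurry fun t => gaussWeight n r t) := by
  unfold gaussWeight Function.uncurry
  have := measurable_S n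
  have := measurable_T n
  fun_prop

lemma measurable_kern (n : ℕ) (r : ℝ) :
    Measurable (Function.uncurry fun t => kern n r t) := by
  unfold kern Function.uncurry
  have := measurable_T n
  have := continuous_gaussCosh.measurable
  fun_prop

lemma integrable_mul_gaussWeight {n : ℕ} {r : ℝ} (hr : 0 < r) {k : ℝ → ℝ → ℝ} {K : ℝ}
    (hk : Measurable (Function.uncurry k)) (hK : ∀ τ t, 0 < τ → |k τ t| ≤ K * (1 + τ))
    {x : Fin n → ℝ} (hT : 0 < T n x) : Integrable fun t => k (T n x) t * gaussWeight n r t x :=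
  (integrable_gaussWeight n hr hT).bdd_mul
    (hk.comp measurable_prodMk_left).aestronglyMeasurable (Eventually.of_forall fun t => hK _ t hT)

lemma abs_mix_gaussWeight_le {n : ℕ} {r : ℝ} (hr : 0 < r) {k : ℝ → ℝ → ℝ} {K : ℝ}
    (hK : ∀ τ t, 0 < τ → |k τ t| ≤ K * (1 + τ)) (x : Fin n → ℝ) :
    |mix n k (gaussWeight n r) x| ≤ K * (1 + T n x) * (r⁻¹ * √(2 * π) * weight n x) := by
  unfold mix
  split_ifs with hT
  · rw [← integral_gaussWeight n hr hT, ← integral_const_mul]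
    rw [← Real.norm_eq_abs]
    refine norm_integral_le_of_norm_le ((integrable_gaussWeight n hr hT).const_mul _)
      (Eventually.of_forall fun t => ?_)
    rw [norm_mul, Real.norm_of_nonneg (show 0 ≤ gaussWeight n r t x from (Real.exp_pos _).le)]
    exact mul_le_mul_of_nonneg_right (hK _ t hT) (Real.exp_pos _).le
  · simp [weight, hT]

lemma integrable_mix_gaussWeight {ρ : Measure ℝ} [IsProbabilityMeasure ρ] {n : ℕ}
    (hTint : Integrable (T n) (Measure.pi fun _ : Fin n => ρ)) {r : ℝ} (hr : 0 < r)
    {k : ℝ → ℝ → ℝ} {K : ℝ} (hk : Measurable (Function.uncurry k))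
    (hK : ∀ τ t, 0 < τ → |k τ t| ≤ K * (1 + τ)) :
    Integrable (mix n k (gaussWeight n r)) (Measure.pi fun _ : Fin n => ρ) := by
  have hb : Integrable (fun x => K * (1 + T n x) * (r⁻¹ * √(2 * π) * weight n x))
      (Measure.pi fun _ : Fin n => ρ) := by
    refine Integrable.mul_bdd (c := r⁻¹ * √(2 * π) * Real.exp (n / 2))
      (((integrable_const 1).add hTint).const_mul K)
      ((measurable_weight n).const_mul _).aestronglyMeasurable (Eventually.of_forall fun x => ?_)
    rw [Real.norm_of_nonneg (mul_nonneg (by positivity) (weight_nonneg n x))]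
    exact mul_le_mul_of_nonneg_left (weight_le n x) (by positivity)
  exact hb.mono' (measurable_mix n hk (measurable_gaussWeight n r)).aestronglyMeasurable
    (Eventually.of_forall fun x => abs_mix_gaussWeight_le hr hK x)

lemma integral_mix_gaussWeight {ρ : Measure ℝ} [IsProbabilityMeasure ρ]
    (hsymm : ρ.map (fun x => -x) = ρ) {n : ℕ}
    (hTint : Integrable (T n) (Measure.pi fun _ : Fin n => ρ)) {r : ℝ} (hr : 0 < r)
    {k : ℝ → ℝ → ℝ} {K : ℝ} (hk : Measurable (Function.uncurry k))
    (hK : ∀ τ t, 0 < τ → |k τ t| ≤ K * (1 + τ)) :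
    ∫ x, mix n k (gaussWeight n r) x ∂(Measure.pi fun _ : Fin n => ρ)
      = ∫ x, mix n k (kern n r) x ∂(Measure.pi fun _ : Fin n => ρ) := by
  rw [integral_eq_integral_average_flip hsymm (integrable_mix_gaussWeight hTint hr hk hK)]
  congr 1
  ext x
  unfold mix
  simp only [T_flip]
  split_ifs with hT
  · rw [← integral_finsetSum, ← integral_const_mul]
    · congr 1
      ext t
      rw [← Finset.mul_sum, mul_left_comm, average_gaussWeight_flip n r t hT]
    · intro e _
      have h := integrable_mul_gaussWeight hr hk hK (x := signFlip n e x) (by rwa [T_flip])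
      rwa [T_flip] at h
  · simp

end Symmetrization

section Limit

/-- The test function `f` evaluated at `√(τ / n) t`, where `n = r⁴`. -/
noncomputable def scaledTest (f : ℝ → ℝ) (r τ t : ℝ) : ℝ := f (√τ / r ^ 2 * t)

lemma measurable_scaledTest {f : ℝ → ℝ} (hf : Continuous f) (r : ℝ) :
    Measurable (Function.uncurry (scaledTest f r)) := by
  unfold scaledTest Function.uncurry
  have := hf.measurable
  fun_prop

lemma mix_one_add (n : ℕ) {r : ℝ} (hr : 0 < r) (x : Fin n → ℝ) :
    mix n (fun τ _ => 1 + τ / r ^ 4) (gaussWeight n r) x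
      = (1 + T n x / r ^ 4) * (r⁻¹ * √(2 * π) * weight n x) := by
  unfold mix
  split_ifs with hT
  · rw [integral_const_mul, integral_gaussWeight n hr hT]
  · simp [weight, hT]

lemma integrable_abs_mul_exp_neg : Integrable fun t : ℝ => |t| * Real.exp (-(1 / 2) * t ^ 2) := by
  have h := (integrable_mul_exp_neg_mul_sq (b := 1 / 2) (by norm_num)).norm
  simpa only [norm_mul, Real.norm_eq_abs, Real.abs_exp] using h

lemma abs_sub_mix_le {n : ℕ} {r : ℝ} (hr : 0 < r) {f : ℝ → ℝ} (hf : Continuous f) {M L : ℝ}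
    (hM : ∀ x, |f x| ≤ M) (hL : ∀ x y, |f x - f y| ≤ L * |x - y|) (x : Fin n → ℝ) :
    |r⁻¹ * √(2 * π) * (f (S n x / r ^ 3) * weight n x)
        - mix n (scaledTest f r) (gaussWeight n r) x|
      ≤ L * (∫ t, |t| * Real.exp (-(1 / 2) * t ^ 2)) / r
        * mix n (fun τ _ => 1 + τ / r ^ 4) (gaussWeight n r) x := by
  have hL0 : 0 ≤ L := by simpa using (abs_nonneg _).trans (hL 1 0)
  rw [mix_one_add n hr]
  by_cases hT : 0 < T n x
  swap
  · simp [weight, mix, hT]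
  have hM0 : 0 ≤ M := (abs_nonneg _).trans (hM 0)
  set κ := ∫ t, |t| * Real.exp (-(1 / 2) * t ^ 2) with hκ
  have hκ0 : 0 ≤ κ := integral_nonneg fun t => by positivity
  have hint := integrable_mul_gaussWeight hr (measurable_scaledTest hf r) (K := M)
    (fun τ t hτ => (hM _).trans (le_mul_of_one_le_right hM0 (by linarith))) hT
  have hgi := integrable_gaussWeight n hr hT
  set b := S n x / √(T n x) with hb
  have hsT : 0 < √(T n x) := Real.sqrt_pos.2 hT
  have hw := weight_nonneg n x
  have hbound : ∀ t, |f (S n x / r ^ 3) * gaussWeight n r t x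
      - scaledTest f r (T n x) t * gaussWeight n r t x|
      ≤ L * (√(T n x) / r ^ 3) * weight n x
        * (|r * t - b| * Real.exp (-(1 / 2) * (r * t - b) ^ 2)) := fun t => by
    rw [← sub_mul, abs_mul, gaussWeight_eq n r t hT, ← hb,
      abs_of_nonneg (mul_nonneg hw (Real.exp_pos _).le)]
    have h1 := hL (S n x / r ^ 3) (√(T n x) / r ^ 2 * t)
    have h2 : S n x / r ^ 3 - √(T n x) / r ^ 2 * t = -(√(T n x) / r ^ 3 * (r * t - b)) := by
      rw [hb]
      field_simp
      ring
    rw [h2, abs_neg, abs_mul, abs_of_pos (by positivity : 0 < √(T n x) / r ^ 3)] at h1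
    calc |f (S n x / r ^ 3) - scaledTest f r (T n x) t|
          * (weight n x * Real.exp (-(1 / 2) * (r * t - b) ^ 2))
        ≤ (L * (√(T n x) / r ^ 3 * |r * t - b|))
          * (weight n x * Real.exp (-(1 / 2) * (r * t - b) ^ 2)) := by
          gcongr
          exact h1
      _ = _ := by ring
  have hmain : |r⁻¹ * √(2 * π) * (f (S n x / r ^ 3) * weight n x)
      - mix n (scaledTest f r) (gaussWeight n r) x|
      ≤ L * (√(T n x) / r ^ 3) * weight n x * (r⁻¹ * κ) := by
    have e1 : r⁻¹ * √(2 * π) * (f (S n x / r ^ 3) * weight n x)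
        = ∫ t, f (S n x / r ^ 3) * gaussWeight n r t x := by
      rw [integral_const_mul, integral_gaussWeight n hr hT]
      ring
    rw [e1, mix, if_pos hT, ← integral_sub (hgi.const_mul _) hint, hκ,
      ← integral_comp_mul_sub (fun t => |t| * Real.exp (-(1 / 2) * t ^ 2)) hr b,
      ← integral_const_mul, ← Real.norm_eq_abs]
    exact norm_integral_le_of_norm_le
      ((integrable_comp_mul_sub integrable_abs_mul_exp_neg hr b).const_mul _)
      (Eventually.of_forall hbound)
  refine hmain.trans ?_
  have h3 : √(T n x) / r ^ 2 ≤ 1 + T n x / r ^ 4 := by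
    have : T n x / r ^ 4 = (√(T n x) / r ^ 2) ^ 2 := by
      rw [div_pow, Real.sq_sqrt hT.le]
      ring
    rw [this]
    nlinarith [sq_nonneg (√(T n x) / r ^ 2 - 1 / 2)]
  have h4 : (1 : ℝ) ≤ √(2 * π) := Real.one_le_sqrt.2 (by nlinarith [Real.pi_gt_three])
  calc L * (√(T n x) / r ^ 3) * weight n x * (r⁻¹ * κ)
      = L * κ / r * ((√(T n x) / r ^ 2) * (r⁻¹ * 1 * weight n x)) := by
        field_simp
    _ ≤ L * κ / r * ((1 + T n x / r ^ 4) * (r⁻¹ * √(2 * π) * weight n x)) := by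
        gcongr

/-- An integrable function dominating `kern`. -/
noncomputable def envelope (t : ℝ) : ℝ := Real.exp (-(1 / 20 * (t ^ 4 / (1 + t ^ 2))))

lemma integrable_envelope : Integrable envelope := by
  have h := (integrable_exp_neg_mul_sq (b := 1 / 20) (by norm_num)).const_mul (Real.exp (1 / 20))
  refine h.mono' ?_ (Eventually.of_forall fun t => ?_)
  · unfold envelope
    exact Measurable.aestronglyMeasurable (by fun_prop)
  · rw [envelope, Real.norm_of_nonneg (Real.exp_pos _).le, ← Real.exp_add, Real.exp_le_exp]
    have : t ^ 2 - 1 ≤ t ^ 4 / (1 + t ^ 2) := by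
      rw [le_div_iff₀ (by positivity)]
      nlinarith
    linarith

lemma integral_envelope_nonneg : 0 ≤ ∫ t, envelope t :=
  integral_nonneg fun _ => (Real.exp_pos _).le

lemma abs_mix_kern_le {n : ℕ} (hn : 1 ≤ n) {k : ℝ → ℝ → ℝ} {B : ℝ → ℝ} (hB : ∀ τ, 0 ≤ τ → 0 ≤ B τ)
    (hk : ∀ τ t, 0 ≤ τ → |k τ t| ≤ B τ) (x : Fin n → ℝ) :
    |mix n k (kern n (scale n)) x| ≤ B (T n x) * ∫ t, envelope t := by
  unfold mix
  split_ifs with hT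
  · rw [← integral_const_mul, ← Real.norm_eq_abs]
    refine norm_integral_le_of_norm_le (integrable_envelope.const_mul _)
      (Eventually.of_forall fun t => ?_)
    rw [norm_mul, Real.norm_of_nonneg (kern_nonneg _ _ _ _)]
    exact mul_le_mul (hk _ t hT.le) (kern_le (one_le_scale hn) (scale_pow_four n) t hT)
      (kern_nonneg _ _ _ _) (hB _ hT.le)
  · simpa using mul_nonneg (hB _ (T_nonneg n x)) integral_envelope_nonneg

lemma tendsto_mix_kern {w : ℕ → ℝ} {m2 m4 m6 : ℝ} (hm2 : 0 < m2)
    (h2 : Tendsto (fun n : ℕ => (∑ i ∈ Finset.range n, w i ^ 2) / n) atTop (𝓝 m2))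
    (h4 : Tendsto (fun n : ℕ => (∑ i ∈ Finset.range n, w i ^ 4) / n) atTop (𝓝 m4))
    (h6 : Tendsto (fun n : ℕ => (∑ i ∈ Finset.range n, w i ^ 6) / n) atTop (𝓝 m6))
    {f : ℝ → ℝ} (hf : Continuous f) {M : ℝ} (hM : ∀ x, |f x| ≤ M) :
    Tendsto (fun n : ℕ => mix n (scaledTest f (scale n)) (kern n (scale n)) fun i => w i) atTop
      (𝓝 (∫ t, f (√m2 * t) * Real.exp (-(m4 / (12 * m2 ^ 2) * t ^ 4)))) := by
  have hM0 : 0 ≤ M := (abs_nonneg _).trans (hM 0)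
  have hT : ∀ n : ℕ, T n (fun i => w i) = ∑ i ∈ Finset.range n, w i ^ 2 := fun n =>
    Fin.sum_univ_eq_sum_range (fun i => w i ^ 2) n
  have hpos : ∀ᶠ n : ℕ in atTop, 1 ≤ n ∧ 0 < T n (fun i => w i) := by
    filter_upwards [h2.eventually_const_lt hm2, eventually_ge_atTop 1] with n hn hn1
    refine ⟨hn1, ?_⟩
    rw [hT]
    by_contra hcon
    exact absurd hn (not_lt.2 (div_nonpos_of_nonpos_of_nonneg (not_lt.1 hcon) (Nat.cast_nonneg n)))
  have hmix : (fun n : ℕ => ∫ t, scaledTest f (scale n) (T n fun i => w i) t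
      * kern n (scale n) t fun i => w i) =ᶠ[atTop]
      fun n : ℕ => mix n (scaledTest f (scale n)) (kern n (scale n)) fun i => w i := by
    filter_upwards [hpos] with n hn
    rw [mix, if_pos hn.2]
  refine Tendsto.congr' hmix ?_
  refine tendsto_integral_filter_of_dominated_convergence (fun t => M * envelope t) ?_ ?_
    (integrable_envelope.const_mul M) ?_
  · refine Eventually.of_forall fun n => ?_
    exact (((measurable_scaledTest hf (scale n)).comp measurable_prodMk_left).mul
      ((measurable_kern n (scale n)).comp
        (measurable_id.prodMk measurable_const))).aestronglyMeasurable
  · filter_upwards [hpos] with n hn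
    refine Eventually.of_forall fun t => ?_
    rw [norm_mul, Real.norm_of_nonneg (kern_nonneg _ _ _ _)]
    exact mul_le_mul (hM _) (kern_le (one_le_scale hn.1) (scale_pow_four n) t hn.2)
      (kern_nonneg _ _ _ _) hM0
  · refine Eventually.of_forall fun t => ?_
    refine Tendsto.mul ?_ (tendsto_kern hm2 h2 h4 h6 t)
    refine (hf.tendsto _).comp (Tendsto.mul_const t ?_)
    refine ((Real.continuous_sqrt.tendsto m2).comp h2).congr fun n => ?_
    have hs : √(n : ℝ) = scale n ^ 2 := by
      rw [← scale_pow_four, show scale n ^ 4 = (scale n ^ 2) ^ 2 by ring,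
        Real.sqrt_sq (sq_nonneg _)]
    rw [Function.comp_apply, hT, ← hs, Real.sqrt_div' _ (Nat.cast_nonneg n)]

lemma ae_tendsto_average_pow (ρ : Measure ℝ) [IsProbabilityMeasure ρ] (p : ℕ)
    (hp : Integrable (fun z : ℝ => z ^ p) ρ) :
    ∀ᵐ w : ℕ → ℝ ∂(Measure.infinitePi fun _ : ℕ => ρ),
      Tendsto (fun n : ℕ => (∑ i ∈ Finset.range n, w i ^ p) / (n : ℝ)) atTop (𝓝 (∫ z, z ^ p ∂ρ)) := by
  have hmp := fun i : ℕ => measurePreserving_eval_infinitePi (fun _ : ℕ => ρ) i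
  have hind := ProbabilityTheory.iIndepFun_infinitePi (P := fun _ : ℕ => ρ)
    (X := fun _ z => z ^ p) (fun _ => by fun_prop)
  have hcomp : ∀ i : ℕ, (fun w : ℕ → ℝ => w i ^ p) = (fun z : ℝ => z ^ p) ∘ Function.eval i :=
    fun i => rfl
  have hint : Integrable (fun w : ℕ → ℝ => w 0 ^ p) (Measure.infinitePi fun _ : ℕ => ρ) := by
    rw [hcomp]
    exact (hmp 0).integrable_comp_of_integrable hp
  have h := ProbabilityTheory.strong_law_ae_real (fun i (w : ℕ → ℝ) => w i ^ p) hint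
    (fun i j hij => hind.indepFun hij) fun i => by
      refine ⟨Measurable.aemeasurable (by fun_prop), Measurable.aemeasurable (by fun_prop), ?_⟩
      rw [hcomp, hcomp, ← Measure.map_map (by fun_prop) (hmp i).measurable,
        ← Measure.map_map (by fun_prop) (hmp 0).measurable, (hmp i).map_eq, (hmp 0).map_eq]
  have hlim : ∫ w : ℕ → ℝ, w 0 ^ p ∂(Measure.infinitePi fun _ : ℕ => ρ) = ∫ z, z ^ p ∂ρ := by
    conv_rhs => rw [← (hmp 0).map_eq]
    rw [integral_map (hmp 0).measurable.aemeasurable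
      (by fun_prop : Measurable fun z : ℝ => z ^ p).aestronglyMeasurable]
  rwa [hlim] at h

lemma measurePreserving_restrict_infinitePi (ρ : Measure ℝ) [IsProbabilityMeasure ρ] (n : ℕ) :
    MeasurePreserving (fun (w : ℕ → ℝ) (i : Fin n) => w i) (Measure.infinitePi fun _ : ℕ => ρ)
      (Measure.pi fun _ : Fin n => ρ) := by
  refine ⟨by fun_prop, ?_⟩
  have hind := (ProbabilityTheory.iIndepFun_infinitePi (P := fun _ : ℕ => ρ)
    (X := fun _ z => z) (fun _ => measurable_id)).precomp (g := fun i : Fin n => (i : ℕ))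
      Fin.val_injective
  rw [(ProbabilityTheory.iIndepFun_iff_map_fun_eq_pi_map 
    (fun i => Measurable.aemeasurable (by fun_prop))).1 hind]
  congr 1
  ext1 i
  exact Measure.infinitePi_map_eval (fun _ : ℕ => ρ) i

lemma tendsto_integral_mix_kern (ρ : Measure ℝ) [IsProbabilityMeasure ρ]
    (hint : ∀ p : ℕ, Integrable (fun z : ℝ => z ^ p) ρ) (hm2 : 0 < ∫ z, z ^ 2 ∂ρ)
    {f : ℝ → ℝ} (hf : Continuous f) {M : ℝ} (hM : ∀ x, |f x| ≤ M) :
    Tendsto (fun n : ℕ => ∫ x, mix n (scaledTest f (scale n)) (kern n (scale n)) x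
        ∂(Measure.pi fun _ : Fin n => ρ)) atTop
      (𝓝 (∫ t, f (√(∫ z, z ^ 2 ∂ρ) * t)
        * Real.exp (-((∫ z, z ^ 4 ∂ρ) / (12 * (∫ z, z ^ 2 ∂ρ) ^ 2) * t ^ 4)))) := by
  have hM0 : 0 ≤ M := (abs_nonneg _).trans (hM 0)
  have hmeas : ∀ n : ℕ, Measurable (mix n (scaledTest f (scale n)) (kern n (scale n))) :=
    fun n => measurable_mix n (measurable_scaledTest hf _) (measurable_kern n _)
  have heq : ∀ n : ℕ, ∫ x, mix n (scaledTest f (scale n)) (kern n (scale n)) x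
      ∂(Measure.pi fun _ : Fin n => ρ)
      = ∫ w : ℕ → ℝ, mix n (scaledTest f (scale n)) (kern n (scale n)) (fun i => w i)
        ∂(Measure.infinitePi fun _ : ℕ => ρ) := fun n => by
    have hmp := measurePreserving_restrict_infinitePi ρ n
    rw [← hmp.map_eq, integral_map hmp.measurable.aemeasurable (hmeas n).aestronglyMeasurable]
  simp_rw [heq]
  have h := tendsto_integral_filter_of_dominated_convergence
    (μ := Measure.infinitePi fun _ : ℕ => ρ) (l := (atTop : Filter ℕ))
    (F := fun n w => mix n (scaledTest f (scale n)) (kern n (scale n)) fun i => w i)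
    (f := fun _ => ∫ t, f (√(∫ z, z ^ 2 ∂ρ) * t)
        * Real.exp (-((∫ z, z ^ 4 ∂ρ) / (12 * (∫ z, z ^ 2 ∂ρ) ^ 2) * t ^ 4)))
    (fun _ => M * ∫ t, envelope t)
    (Eventually.of_forall fun n => ((hmeas n).comp (by fun_prop)).aestronglyMeasurable)
    (by
      filter_upwards [eventually_ge_atTop 1] with n hn
      exact Eventually.of_forall fun w =>
        abs_mix_kern_le hn (B := fun _ => M) (fun _ _ => hM0) (fun _ _ _ => hM _) _)
    (integrable_const _)
    (by
      filter_upwards [ae_tendsto_average_pow ρ 2 (hint 2), ae_tendsto_average_pow ρ 4 (hint 4),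
        ae_tendsto_average_pow ρ 6 (hint 6)] with w h2 h4 h6
      exact tendsto_mix_kern hm2 h2 h4 h6 hf hM)
  simpa using h

lemma integrable_T {ρ : Measure ℝ} [IsProbabilityMeasure ρ]
    (h2 : Integrable (fun z : ℝ => z ^ 2) ρ) (n : ℕ) :
    Integrable (T n) (Measure.pi fun _ : Fin n => ρ) := by
  have h : ∀ i : Fin n, Integrable (fun x : Fin n → ℝ => x i ^ 2) (Measure.pi fun _ : Fin n => ρ) :=
    fun i => (measurePreserving_eval (fun _ : Fin n => ρ) i).integrable_comp_of_integrable h2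
  exact integrable_finsetSum _ fun i _ => h i

lemma integral_T {ρ : Measure ℝ} [IsProbabilityMeasure ρ]
    (h2 : Integrable (fun z : ℝ => z ^ 2) ρ) (n : ℕ) :
    ∫ x, T n x ∂(Measure.pi fun _ : Fin n => ρ) = n * ∫ z, z ^ 2 ∂ρ := by
  have hmp := fun i : Fin n => measurePreserving_eval (fun _ : Fin n => ρ) i
  have h : ∀ i : Fin n, Integrable (fun x : Fin n → ℝ => x i ^ 2) (Measure.pi fun _ : Fin n => ρ) :=
    fun i => (hmp i).integrable_comp_of_integrable h2
  have h' : ∀ i : Fin n, ∫ x : Fin n → ℝ, x i ^ 2 ∂(Measure.pi fun _ : Fin n => ρ)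
      = ∫ z, z ^ 2 ∂ρ := fun i => by
    conv_rhs => rw [← (hmp i).map_eq]
    rw [integral_map (hmp i).measurable.aemeasurable
      (by fun_prop : Measurable fun z : ℝ => z ^ 2).aestronglyMeasurable]
  unfold T
  rw [integral_finsetSum _ fun i _ => h i]
  simp [h']

lemma tendsto_integral_weight {ρ : Measure ℝ} [IsProbabilityMeasure ρ]
    (hsymm : ρ.map (fun x => -x) = ρ)
    (hint : ∀ p : ℕ, Integrable (fun z : ℝ => z ^ p) ρ) (hm2 : 0 < ∫ z, z ^ 2 ∂ρ)
    {f : ℝ → ℝ} (hf : Continuous f) {M L : ℝ}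
    (hM : ∀ x, |f x| ≤ M) (hL : ∀ x y, |f x - f y| ≤ L * |x - y|) :
    Tendsto (fun n : ℕ => (scale n)⁻¹ * √(2 * π)
        * ∫ x, f (S n x / scale n ^ 3) * weight n x ∂(Measure.pi fun _ : Fin n => ρ)) atTop
      (𝓝 (∫ t, f (√(∫ z, z ^ 2 ∂ρ) * t)
        * Real.exp (-((∫ z, z ^ 4 ∂ρ) / (12 * (∫ z, z ^ 2 ∂ρ) ^ 2) * t ^ 4)))) := by
  have hM0 : 0 ≤ M := (abs_nonneg _).trans (hM 0)
  have hL0 : 0 ≤ L := by simpa using (abs_nonneg _).trans (hL 1 0)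
  set κ := ∫ t, |t| * Real.exp (-(1 / 2) * t ^ 2) with hκ
  have hκ0 : 0 ≤ κ := integral_nonneg fun t => by positivity
  set C := (1 + ∫ z, z ^ 2 ∂ρ) * ∫ t, envelope t with hC
  have hlim := tendsto_integral_mix_kern ρ hint hm2 hf hM
  have hsmall : Tendsto (fun n : ℕ => L * κ / scale n * C) atTop (𝓝 0) := by
    simpa using ((tendsto_const_nhds (x := L * κ)).div_atTop tendsto_scale).mul_const C
  refine hlim.congr_dist (squeeze_zero' (Eventually.of_forall fun _ => dist_nonneg) ?_ hsmall)
  filter_upwards [eventually_ge_atTop 1] with n hn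
  have hr : 0 < scale n := zero_lt_one.trans_le (one_le_scale hn)
  have hn0 : (0 : ℝ) < n := by exact_mod_cast hn
  have hTi := integrable_T (hint 2) n
  have hK : ∀ τ t, 0 < τ → |scaledTest f (scale n) τ t| ≤ M * (1 + τ) := fun τ t hτ =>
    (hM _).trans (le_mul_of_one_le_right hM0 (by linarith))
  have hk := measurable_scaledTest hf (scale n)
  have hK' : ∀ τ (t : ℝ), 0 < τ → |(fun τ _ => 1 + τ / scale n ^ 4 : ℝ → ℝ → ℝ) τ t|
      ≤ 1 * (1 + τ) := fun τ t hτ => by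
    have : τ / scale n ^ 4 ≤ τ :=
      div_le_self hτ.le (one_le_pow₀ (one_le_scale hn))
    rw [abs_of_nonneg (by positivity)]
    linarith
  have hk' : Measurable (Function.uncurry (fun τ _ => 1 + τ / scale n ^ 4 : ℝ → ℝ → ℝ)) := by
    unfold Function.uncurry
    fun_prop
  have hfw : Integrable (fun x => f (S n x / scale n ^ 3) * weight n x)
      (Measure.pi fun _ : Fin n => ρ) := by
    refine Integrable.of_bound (C := M * Real.exp (n / 2)) ?_ (Eventually.of_forall fun x => ?_)
    · exact ((hf.measurable.comp ((measurable_S n).div_const _)).mul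
        (measurable_weight n)).aestronglyMeasurable
    · rw [norm_mul, Real.norm_of_nonneg (weight_nonneg n x)]
      exact mul_le_mul (hM _) (weight_le n x) (weight_nonneg n x) hM0
  rw [dist_comm, Real.dist_eq, ← integral_mix_gaussWeight hsymm hTi hr hk hK,
    ← integral_const_mul, ← integral_sub (hfw.const_mul _) (integrable_mix_gaussWeight hTi hr hk hK)]
  have hbi : Integrable (fun x => (1 + T n x / scale n ^ 4) * ∫ t, envelope t)
      (Measure.pi fun _ : Fin n => ρ) :=
    (((integrable_const 1).add (hTi.div_const _))).mul_const _
  have h1 : ∫ x, mix n (fun τ _ => 1 + τ / scale n ^ 4) (gaussWeight n (scale n)) x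
      ∂(Measure.pi fun _ : Fin n => ρ) ≤ C := by
    rw [integral_mix_gaussWeight hsymm hTi hr hk' hK']
    have hbd := fun x => (le_abs_self _).trans
      (abs_mix_kern_le hn (k := fun τ _ => 1 + τ / scale n ^ 4) (B := fun τ => 1 + τ / scale n ^ 4)
        (fun τ hτ => by positivity) (fun τ t hτ => (abs_of_nonneg (by positivity)).le) x)
    calc _ ≤ ∫ x, (1 + T n x / scale n ^ 4) * (∫ t, envelope t)
          ∂(Measure.pi fun _ : Fin n => ρ) := by
          refine integral_mono_of_nonneg (Eventually.of_forall fun x => ?_) hbi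
            (Eventually.of_forall hbd)
          unfold mix
          have hTx := T_nonneg n x
          simp only [Pi.zero_apply]
          split_ifs
          · exact integral_nonneg fun t => mul_nonneg (by positivity) (kern_nonneg _ _ _ _)
          · exact le_rfl
      _ = C := by
          rw [integral_mul_const, integral_add (integrable_const 1) (hTi.div_const _),
            integral_div, integral_T (hint 2), scale_pow_four, hC]
          simp only [integral_const, probReal_univ, smul_eq_mul, mul_one]
          field_simp
  rw [← Real.norm_eq_abs]
  refine (norm_integral_le_of_norm_le
    ((integrable_mix_gaussWeight hTi hr hk' hK').const_mul (L * κ / scale n))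
    (Eventually.of_forall fun x => abs_sub_mix_le hr hf hM hL x)).trans ?_
  rw [integral_const_mul]
  exact mul_le_mul_of_nonneg_left h1 (by positivity)

end Limit

section Assembly

lemma integrable_pow_of_integrable_exp_sq {ρ : Measure ℝ} [IsProbabilityMeasure ρ] {v : ℝ}
    (hv : 0 < v) (h : Integrable (fun z : ℝ => Real.exp (v * z ^ 2)) ρ) (p : ℕ) :
    Integrable (fun z : ℝ => z ^ p) ρ := by
  refine ((integrable_const (1 : ℝ)).add (h.const_mul (p.factorial / v ^ p))).mono'
    (by fun_prop : Measurable fun z : ℝ => z ^ p).aestronglyMeasurable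
    (Eventually.of_forall fun z => ?_)
  have h1 := Real.pow_div_factorial_le_exp (v * z ^ 2) (by positivity) p
  have h2 : |z| ^ p ≤ 1 + (z ^ 2) ^ p := by
    rw [← sq_abs, ← pow_mul, mul_comm, pow_mul]
    nlinarith [sq_nonneg (|z| ^ p - 1 / 2)]
  have hfac : (0 : ℝ) < p.factorial := by exact_mod_cast p.factorial_pos
  have h3 : (z ^ 2) ^ p ≤ p.factorial / v ^ p * Real.exp (v * z ^ 2) := by
    rw [div_le_iff₀ hfac, mul_pow] at h1
    rw [div_mul_eq_mul_div, le_div_iff₀ (by positivity)]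
    linarith
  rw [norm_pow, Real.norm_eq_abs]
  simp only [Pi.add_apply]
  linarith

lemma integral_even_pow_pos {ρ : Measure ℝ} [IsProbabilityMeasure ρ] (hne : ρ ≠ Measure.dirac 0)
    {p : ℕ} (hp : Even p) (hp0 : p ≠ 0) (hint : Integrable (fun z : ℝ => z ^ p) ρ) :
    0 < ∫ z, z ^ p ∂ρ := by
  have hnn : 0 ≤ fun z : ℝ => z ^ p := fun z => hp.pow_nonneg z
  refine lt_of_le_of_ne (integral_nonneg hnn) fun h0 => hne ?_
  have h := (integral_eq_zero_iff_of_nonneg hnn hint).1 h0.symm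
  have hae : (id : ℝ → ℝ) =ᵐ[ρ] fun _ => 0 := by
    filter_upwards [h] with z hz
    exact pow_eq_zero_iff hp0 |>.1 hz
  rw [← Measure.map_id (μ := ρ), Measure.map_congr hae, Measure.map_const]
  simp

lemma variance_id_of_symm {ρ : Measure ℝ} [IsProbabilityMeasure ρ]
    (hsymm : ρ.map (fun x => -x) = ρ) : ProbabilityTheory.variance id ρ = ∫ z, z ^ 2 ∂ρ := by
  have h0 : ∫ z, id z ∂ρ = 0 := by
    have h := integral_map (μ := ρ) (φ := fun x : ℝ => -x) measurable_neg.aemeasurable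
      (f := fun z : ℝ => z) measurable_id.aestronglyMeasurable
    rw [hsymm, integral_neg] at h
    simp only [id]
    linarith
  exact ProbabilityTheory.variance_of_integral_eq_zero aemeasurable_id h0

lemma integral_exp_neg_mul_pow_four {b : ℝ} (hb : 0 < b) :
    ∫ s : ℝ, Real.exp (-(b * s ^ 4)) = 2 * (b ^ (-(1 / 4 : ℝ)) * (1 / 4) * Real.Gamma (1 / 4)) := by
  have h1 := integral_comp_abs (f := fun s : ℝ => Real.exp (-(b * s ^ 4)))
  simp only [(show Even 4 by decide).pow_abs] at h1
  rw [h1]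
  congr 1
  have h2 := integral_rpow_mul_exp_neg_mul_rpow (p := 4) (q := 0) (b := b)
    (by norm_num) (by norm_num) hb
  rw [show (-(0 + 1) / 4 : ℝ) = -(1 / 4) by norm_num,
    show ((0 + 1) / 4 : ℝ) = 1 / 4 by norm_num] at h2
  rw [← h2]
  refine setIntegral_congr_fun measurableSet_Ioi fun s _ => ?_
  have h4 : s ^ (4 : ℝ) = s ^ 4 := by exact_mod_cast Real.rpow_natCast s 4
  simp [h4]

lemma integrable_exp_neg_mul_pow_four {b : ℝ} (hb : 0 < b) :
    Integrable fun s : ℝ => Real.exp (-(b * s ^ 4)) := by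
  refine Integrable.of_integral_ne_zero ?_
  rw [integral_exp_neg_mul_pow_four hb]
  have := Real.Gamma_pos_of_pos (show (0 : ℝ) < 1 / 4 by norm_num)
  positivity

lemma density_const_mul_integral {m2 m4 : ℝ} (hm2 : 0 < m2) (hm4 : 0 < m4) :
    ((4 * m4 / (3 * m2 ^ 4)) ^ (1 / 4 : ℝ) * (Real.Gamma (1 / 4))⁻¹)
      * ∫ s : ℝ, Real.exp (-(m4 * s ^ 4 / (12 * m2 ^ 4))) = 1 := by
  set b := m4 / (12 * m2 ^ 4) with hb
  have hb0 : 0 < b := by positivity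
  have h1 : ∀ s : ℝ, m4 * s ^ 4 / (12 * m2 ^ 4) = b * s ^ 4 := fun s => by rw [hb]; ring
  have h2 : 4 * m4 / (3 * m2 ^ 4) = 2 ^ (4 : ℝ) * b := by
    rw [hb]
    norm_num
    field_simp
    norm_num
  have hG := Real.Gamma_pos_of_pos (show (0 : ℝ) < 1 / 4 by norm_num)
  have hbp : 0 < b ^ (1 / 4 : ℝ) := Real.rpow_pos_of_pos hb0 _
  simp_rw [h1]
  rw [integral_exp_neg_mul_pow_four hb0, h2, Real.mul_rpow (by positivity) hb0.le,
    ← Real.rpow_mul two_pos.le, Real.rpow_neg hb0.le]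
  norm_num
  field_simp
  norm_num

lemma integral_tildeMu {ρ : Measure ℝ} [IsProbabilityMeasure ρ] {n : ℕ} (hZ : 0 < Z ρ n)
    (g : (Fin n → ℝ) → ℝ) :
    ∫ x, g x ∂(tildeMu ρ n)
      = (Z ρ n)⁻¹ * ∫ x, g x * weight n x ∂(Measure.pi fun _ : Fin n => ρ) := by
  rw [tildeMu, integral_smul_measure, integral_withDensity_eq_integral_toReal_smul
    (measurable_weight n).ennreal_ofReal (Eventually.of_forall fun _ => ENNReal.ofReal_lt_top),
    ENNReal.toReal_inv, ENNReal.toReal_ofReal hZ.le, smul_eq_mul]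
  congr 1
  refine integral_congr_ae (Eventually.of_forall fun x => ?_)
  simp only [ENNReal.toReal_ofReal (weight_nonneg n x), smul_eq_mul, mul_comm]

lemma isProbabilityMeasure_tildeMu {ρ : Measure ℝ} [IsProbabilityMeasure ρ] {n : ℕ}
    (hZ : 0 < Z ρ n) : IsProbabilityMeasure (tildeMu ρ n) := by
  have hw : Integrable (weight n) (Measure.pi fun _ : Fin n => ρ) :=
    Integrable.of_integral_ne_zero hZ.ne'
  refine ⟨?_⟩
  rw [tildeMu, Measure.smul_apply, withDensity_apply _ MeasurableSet.univ, Measure.restrict_univ,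
    ← ofReal_integral_eq_lintegral_ofReal hw (Eventually.of_forall (weight_nonneg n)), smul_eq_mul]
  exact ENNReal.inv_mul_cancel (ENNReal.ofReal_pos.2 hZ).ne' ENNReal.ofReal_ne_top

lemma integral_comp_sqrt_mul {m2 m4 : ℝ} (hm2 : 0 < m2) (f : ℝ → ℝ) :
    ∫ t, f (√m2 * t) * Real.exp (-(m4 / (12 * m2 ^ 2) * t ^ 4))
      = (√m2)⁻¹ * ∫ s, f s * Real.exp (-(m4 * s ^ 4 / (12 * m2 ^ 4))) := by
  have hs : 0 < √m2 := Real.sqrt_pos.2 hm2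
  have h := Measure.integral_comp_mul_left
    (fun s => f s * Real.exp (-(m4 * s ^ 4 / (12 * m2 ^ 4)))) (√m2)
  rw [abs_of_pos (inv_pos.2 hs), smul_eq_mul] at h
  rw [← h]
  congr 1
  ext t
  have h4 : √m2 ^ 4 = m2 ^ 2 := by
    rw [show (4 : ℕ) = 2 * 2 by norm_num, pow_mul, Real.sq_sqrt hm2.le]
  rw [mul_pow, h4]
  congr 3
  field_simp

/-- The limiting distribution of `Sₙ / n^{3/4}`. -/
noncomputable def quarticMeasure (D b : ℝ) : Measure ℝ :=
  volume.withDensity fun s => ENNReal.ofReal (D * Real.exp (-(b * s ^ 4)))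

lemma integral_quarticMeasure {D b : ℝ} (hD : 0 ≤ D) (f : ℝ → ℝ) :
    ∫ s, f s ∂(quarticMeasure D b) = ∫ s, f s * (D * Real.exp (-(b * s ^ 4))) := by
  rw [quarticMeasure, integral_withDensity_eq_integral_toReal_smul
    (by fun_prop) (Eventually.of_forall fun _ => ENNReal.ofReal_lt_top)]
  refine integral_congr_ae (Eventually.of_forall fun s => ?_)
  simp only [ENNReal.toReal_ofReal (mul_nonneg hD (Real.exp_pos _).le), smul_eq_mul, mul_comm]

lemma isProbabilityMeasure_quarticMeasure {D b : ℝ} (hD : 0 ≤ D) (hb : 0 < b)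
    (h1 : D * ∫ s : ℝ, Real.exp (-(b * s ^ 4)) = 1) :
    IsProbabilityMeasure (quarticMeasure D b) := by
  refine ⟨?_⟩
  rw [quarticMeasure, withDensity_apply _ MeasurableSet.univ, Measure.restrict_univ,
    ← ofReal_integral_eq_lintegral_ofReal ((integrable_exp_neg_mul_pow_four hb).const_mul D)
      (Eventually.of_forall fun s => mul_nonneg hD (Real.exp_pos _).le), integral_const_mul, h1,
    ENNReal.ofReal_one]

end Assembly

/-- if `ρ` is a symmetric probability measure on `ℝ`, not the Dirac mass
at `0`, such that `∫ exp(v₀ z²) dρ(z) < ∞` for some `v₀ > 0`, with variance `σ²` and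
fourth moment `μ₄`, then under `μ̃_{n,ρ}` the random variable `Sₙ/n^{3/4}` converges in
distribution to the probability distribution on `ℝ` with density
`s ↦ (4μ₄/(3σ⁸))^{1/4} Γ(1/4)⁻¹ exp(−μ₄ s⁴/(12σ⁸))` with respect to Lebesgue measure. -/
theorem fluctuations_sum
    (ρ : Measure ℝ) [IsProbabilityMeasure ρ]
    (hsymm : ρ.map (fun x => -x) = ρ)
    (hne : ρ ≠ Measure.dirac 0)
    (hexp : ∃ v₀ : ℝ, 0 < v₀ ∧ Integrable (fun z : ℝ => Real.exp (v₀ * z ^ 2)) ρ)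
    (σ2 μ4 : ℝ)
    (hσ2 : σ2 = ProbabilityTheory.variance id ρ)
    (hμ4 : μ4 = ∫ x : ℝ, x ^ 4 ∂ρ) :
    ∀ f : BoundedContinuousFunction ℝ ℝ,
      Tendsto
        (fun n : ℕ => ∫ x, f (S n x / (n : ℝ) ^ (3/4 : ℝ)) ∂(tildeMu ρ n))
        atTop
        (𝓝 (∫ s : ℝ, f s *
          ((4 * μ4 / (3 * σ2 ^ 4)) ^ (1/4 : ℝ) * (Real.Gamma (1/4))⁻¹ *
            Real.exp (-(μ4 * s ^ 4 / (12 * σ2 ^ 4)))))) := by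
  obtain ⟨v, hv, hvint⟩ := hexp
  have hint := integrable_pow_of_integrable_exp_sq hv hvint
  rw [variance_id_of_symm hsymm] at hσ2
  have hm2 : 0 < σ2 := hσ2 ▸ integral_even_pow_pos hne even_two two_ne_zero (hint 2)
  have hm4 : 0 < μ4 := hμ4 ▸ integral_even_pow_pos hne (by decide) (by norm_num) (hint 4)
  set D : ℝ := (4 * μ4 / (3 * σ2 ^ 4)) ^ (1/4 : ℝ) * (Real.Gamma (1/4))⁻¹ with hD
  set b : ℝ := μ4 / (12 * σ2 ^ 4) with hb
  have hb0 : 0 < b := by positivity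
  have hbs : ∀ s : ℝ, μ4 * s ^ 4 / (12 * σ2 ^ 4) = b * s ^ 4 := fun s => by rw [hb]; ring
  have hDJ := density_const_mul_integral hm2 hm4
  rw [← hD] at hDJ
  simp_rw [hbs] at hDJ ⊢
  have hG := Real.Gamma_pos_of_pos (show (0 : ℝ) < 1 / 4 by norm_num)
  have hD0 : 0 < D := by positivity
  have hs2 : 0 < √σ2 := Real.sqrt_pos.2 hm2
  have hkey : ∀ {g : ℝ → ℝ} {M L : ℝ}, Continuous g → (∀ x, |g x| ≤ M) →
      (∀ x y, |g x - g y| ≤ L * |x - y|) →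
      Tendsto (fun n : ℕ => (scale n)⁻¹ * √(2 * π)
        * ∫ x, g (S n x / scale n ^ 3) * weight n x ∂(Measure.pi fun _ : Fin n => ρ)) atTop
        (𝓝 ((√σ2)⁻¹ * ∫ s, g s * Real.exp (-(b * s ^ 4)))) := fun hg hM hL => by
    have h := tendsto_integral_weight hsymm hint (hσ2 ▸ hm2) hg hM hL
    rw [← hσ2, ← hμ4, integral_comp_sqrt_mul hm2] at h
    simpa only [hbs] using h
  have hJ : 0 < ∫ s : ℝ, Real.exp (-(b * s ^ 4)) := by
    by_contra hcon
    nlinarith [mul_nonneg hD0.le (neg_nonneg.2 (not_lt.1 hcon))]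
  have hZlim : Tendsto (fun n : ℕ => (scale n)⁻¹ * √(2 * π) * Z ρ n) atTop
      (𝓝 ((√σ2)⁻¹ * ∫ s, Real.exp (-(b * s ^ 4)))) := by
    simpa [Z] using hkey (g := fun _ => 1) (M := 1) (L := 0) continuous_const (by simp) (by simp)
  have hZpos : ∀ᶠ n : ℕ in atTop, 0 < Z ρ n := by
    filter_upwards [hZlim.eventually_const_lt (mul_pos (inv_pos.2 hs2) hJ),
      eventually_ge_atTop 1] with n hn hn1
    have hr : 0 < scale n := zero_lt_one.trans_le (one_le_scale hn1)
    exact pos_of_mul_pos_right hn (by positivity)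
  have hmeas : ∀ n : ℕ, Measurable fun x : Fin n → ℝ => S n x / (n : ℝ) ^ (3/4 : ℝ) :=
    fun n => (measurable_S n).div_const _
  have hprob : ∀ n : ℕ, 0 < Z ρ n →
      IsProbabilityMeasure ((tildeMu ρ n).map fun x => S n x / (n : ℝ) ^ (3/4 : ℝ)) :=
    fun n hZ => by
      have := isProbabilityMeasure_tildeMu hZ
      exact Measure.isProbabilityMeasure_map (hmeas n).aemeasurable
  classical
  let ν : ℕ → ProbabilityMeasure ℝ := fun n =>
    if h : 0 < Z ρ n then ⟨_, hprob n h⟩ else ⟨Measure.dirac 0, inferInstance⟩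
  let P : ProbabilityMeasure ℝ :=
    ⟨quarticMeasure D b, isProbabilityMeasure_quarticMeasure hD0.le hb0 hDJ⟩
  have hν : ∀ {n : ℕ}, 0 < Z ρ n → ∀ {g : ℝ → ℝ}, Continuous g →
      ∫ s, g s ∂(ν n : Measure ℝ)
        = ∫ x, g (S n x / (n : ℝ) ^ (3/4 : ℝ)) ∂(tildeMu ρ n) := fun {n} hZ {g} hg => by
    have h1 : (ν n : Measure ℝ) = (tildeMu ρ n).map fun x => S n x / (n : ℝ) ^ (3/4 : ℝ) := by
      have h2 : ν n = ⟨_, hprob n hZ⟩ := dif_pos hZ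
      rw [h2, ProbabilityMeasure.coe_mk]
    rw [h1, integral_map (hmeas n).aemeasurable hg.aestronglyMeasurable]
  have hconv : Tendsto ν atTop (𝓝 P) := by
    rw [tendsto_iff_forall_lipschitz_integral_tendsto]
    rintro g ⟨C, hC⟩ ⟨L, hL⟩
    have hM : ∀ x, |g x| ≤ |g 0| + C := fun x => by
      have h1 := hC x 0
      rw [Real.dist_eq] at h1
      linarith [abs_sub_abs_le_abs_sub (g x) (g 0)]
    have hL' : ∀ x y, |g x - g y| ≤ L * |x - y| := fun x y => by
      simpa [Real.dist_eq] using hL.dist_le_mul x y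
    have hratio := (hkey hL.continuous hM hL').div hZlim (mul_pos (inv_pos.2 hs2) hJ).ne'
    have hlim : (√σ2)⁻¹ * (∫ s, g s * Real.exp (-(b * s ^ 4)))
        / ((√σ2)⁻¹ * ∫ s, Real.exp (-(b * s ^ 4))) = ∫ s, g s ∂(P : Measure ℝ) := by
      have h1 : ∫ s, g s ∂(P : Measure ℝ) = D * ∫ s, g s * Real.exp (-(b * s ^ 4)) := by
        rw [ProbabilityMeasure.coe_mk, integral_quarticMeasure hD0.le, ← integral_const_mul]
        simp only [mul_left_comm]
      rw [h1, mul_div_mul_left _ _ (inv_pos.2 hs2).ne', div_eq_iff hJ.ne', mul_right_comm, hDJ,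
        one_mul]
    rw [hlim] at hratio
    refine hratio.congr' ?_
    filter_upwards [hZpos, eventually_ge_atTop 1] with n hZ hn1
    have hr : 0 < scale n := zero_lt_one.trans_le (one_le_scale hn1)
    rw [hν hZ hL.continuous, integral_tildeMu hZ, ← scale_pow_three]
    simp only [Pi.div_apply]
    rw [mul_div_mul_left _ _ (by positivity), div_eq_inv_mul]
  intro f
  have h := (ProbabilityMeasure.tendsto_iff_forall_integral_tendsto.1 hconv) f
  rw [show ∫ s, f s ∂(P : Measure ℝ) = ∫ s, f s * (D * Real.exp (-(b * s ^ 4))) from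
    integral_quarticMeasure hD0.le f] at h
  refine h.congr' ?_
  filter_upwards [hZpos] with n hZ
  exact hν hZ f.continuous
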